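/- For all integers T ≥ K ≥ 1, the minimax regret of one-dimensional switching-constrained online linear optimization satisfies R₁(T,K) ≥ T/(2√K). -/

import Mathlib

/-- The increment in the number of switches when the player, whose previous action is
`last` (`none` at the first round), plays `x`. -/
noncomputable def switchInc (last : Option ℝ) (x : ℝ) : ℕ :=
  match last with
  | none => 0
  | some y => if x = y then 0 else 1

/-- Backward-recursive value of the one-dimensional switching-constrained online linear
optimization game: `gameVal1 K t last s W` is the value of the game with `t` rounds
remaining, previous player action `last`, `s` switches used so far, and accumulated
adversary sum `W`.  The player's infimum ranges only over actions in `[-1,1]` keeping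
the total number of switches strictly below `K` (equivalently, the payoff is `+∞` as soon
as `K` switches are reached), the adversary's supremum ranges over `[-1,1]`, and at the
end the comparator term `|∑ wᵢ|` is added. -/
noncomputable def gameVal1 (K : ℕ) : ℕ → Option ℝ → ℕ → ℝ → ℝ
  | 0, _, _, W => |W|
  | t + 1, last, s, W =>
      sInf ((fun x : ℝ =>
        sSup ((fun w : ℝ => w * x + gameVal1 K t (some x) (s + switchInc last x) (W + w)) ''
          Set.Icc (-1 : ℝ) 1)) ''
        {x : ℝ | x ∈ Set.Icc (-1 : ℝ) 1 ∧ s + switchInc last x < K})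

/-- `R₁(T,K)`: the minimax regret of `T`-round one-dimensional switching-constrained
online linear optimization with fewer than `K` switches. -/
noncomputable def R1 (T K : ℕ) : ℝ := gameVal1 K T none 0 0

/-- The Huber function: the maximum of `y * W + b * (1 - y ^ 2)` over `y ∈ [-1, 1]`. -/
noncomputable def huber (b W : ℝ) : ℝ :=
  if |W| ≤ 2 * b then b + W ^ 2 / (4 * b) else |W|

lemma huber_neg (b W : ℝ) : huber b (-W) = huber b W := by
  simp [huber]

lemma le_huber {b y : ℝ} (W : ℝ) (hb : 0 < b) (hy : |y| ≤ 1) :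
    y * W + b * (1 - y ^ 2) ≤ huber b W := by
  unfold huber
  split_ifs with h
  · have key : b + W ^ 2 / (4 * b) - (y * W + b * (1 - y ^ 2)) = (W - 2 * b * y) ^ 2 / (4 * b) := by
      field_simp
      ring
    have : 0 ≤ (W - 2 * b * y) ^ 2 / (4 * b) := by positivity
    linarith
  · push Not at h
    have h1 : y * W ≤ |y| * |W| := by
      rw [← abs_mul]
      exact le_abs_self _
    have h2 : y ^ 2 = |y| ^ 2 := (sq_abs y).symm
    rw [h2]
    nlinarith [mul_nonneg (sub_nonneg.2 hy) (sub_nonneg.2 h.le), abs_nonneg y,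
      mul_nonneg hb.le (mul_nonneg (sub_nonneg.2 hy) (sub_nonneg.2 hy))]

lemma exists_huber_eq {b : ℝ} (W : ℝ) (hb : 0 < b) :
    ∃ y : ℝ, |y| ≤ 1 ∧ huber b W = y * W + b * (1 - y ^ 2) ∧
      (W = 2 * b * y ∨ y = 1 ∨ y = -1) := by
  unfold huber
  split_ifs with h
  · refine ⟨W / (2 * b), ?_, ?_, Or.inl ?_⟩
    · rw [abs_div, abs_of_pos (by positivity : 0 < 2 * b)]
      exact (div_le_one (by positivity)).2 h
    · field_simp
      ring
    · field_simp
  · rcases le_total 0 W with hW | hW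
    · exact ⟨1, by simp, by simp [abs_of_nonneg hW], Or.inr (Or.inl rfl)⟩
    · exact ⟨-1, by simp, by simp [abs_of_nonpos hW], Or.inr (Or.inr rfl)⟩

/-- The slope used against a player who switches after `s` of the `t` remaining rounds. -/
lemma exists_slope {a a' t s y : ℝ} (ha : 0 < a) (haa : a * a' ^ 2 ≤ a' - a)
    (hs : 0 < s) (hst : s < t) (hy : |y| ≤ 1) :
    ∃ z : ℝ, |z| ≤ 1 ∧
      a * t * (1 - y ^ 2) ≤ (z - y) * (2 * (a * t) * y + s) + a' * (t - s) * (1 - z ^ 2) := by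
  obtain ⟨hy1, hy2⟩ := abs_le.1 hy
  have ht : 0 < t := hs.trans hst
  have haa' : a ≤ a' := by nlinarith [mul_nonneg ha.le (sq_nonneg a')]
  obtain ⟨A, hA⟩ : ∃ A, A = a' * (t - s) := ⟨_, rfl⟩
  have hA0 : 0 < A := hA ▸ mul_pos (ha.trans_le haa') (by linarith)
  obtain ⟨B, hB⟩ : ∃ B, B = a * t := ⟨_, rfl⟩
  have hB0 : 0 < B := hB ▸ mul_pos ha ht
  have hdisc : 4 * B * (B - A) ≤ s ^ 2 := by
    have : s ^ 2 - 4 * B * (B - A) =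
        (s - 2 * a * a' * t) ^ 2 + 4 * a * t ^ 2 * (a' - a - a * a' ^ 2) := by
      rw [hA, hB]
      ring
    have h2 : 0 ≤ 4 * a * t ^ 2 * (a' - a - a * a' ^ 2) :=
      mul_nonneg (by positivity) (by linarith)
    nlinarith [sq_nonneg (s - 2 * a * a' * t)]
  rw [← hA, ← hB]
  have hy2' : 0 ≤ 1 - y ^ 2 := by nlinarith
  rcases le_total B A with hBA | hAB
  · exact ⟨y, hy, by nlinarith⟩
  rcases le_total (B * (1 - y)) s with hsB | hsB
  · exact ⟨1, by simp, by nlinarith [mul_nonneg (sub_nonneg.2 hy2) (sub_nonneg.2 hsB)]⟩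
  · have hc : 4 * (B - A) ≤ s * (1 - y) := by
      have : B * (4 * (B - A)) ≤ B * (s * (1 - y)) := by nlinarith
      exact le_of_mul_le_mul_left this hB0
    obtain ⟨d, hd⟩ : ∃ d, d = (s + 2 * y * (B - A)) / (2 * A) := ⟨_, rfl⟩
    have hdA : 2 * A * d = s + 2 * y * (B - A) := by
      rw [hd]
      field_simp
    have hd0 : 0 ≤ d := by
      rw [hd]
      apply div_nonneg _ (by linarith)
      nlinarith
    have hd1 : d ≤ 1 - y := by
      rw [hd, div_le_iff₀ (by linarith)]
      nlinarith
    refine ⟨y + d, abs_le.2 ⟨by linarith, by linarith⟩, ?_⟩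
    have hsq : 4 * A * ((B - A) * (1 - y ^ 2)) ≤ (s + 2 * y * (B - A)) ^ 2 := by
      have h1 : B * ((s + 2 * y * (B - A)) ^ 2 - 4 * A * ((B - A) * (1 - y ^ 2))) =
          A * (s ^ 2 - 4 * B * (B - A)) + (B - A) * (s + 2 * B * y) ^ 2 := by
        ring
      have h2 : 0 ≤ A * (s ^ 2 - 4 * B * (B - A)) + (B - A) * (s + 2 * B * y) ^ 2 :=
        add_nonneg (mul_nonneg hA0.le (by linarith))
          (mul_nonneg (by linarith) (sq_nonneg _))
      rw [← h1] at h2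
      have := nonneg_of_mul_nonneg_right h2 hB0
      linarith
    have h3 : (B - A) * (1 - y ^ 2) ≤ A * d ^ 2 := by
      rw [← hdA] at hsq
      have : 4 * A * ((B - A) * (1 - y ^ 2)) ≤ 4 * A * (A * d ^ 2) := by nlinarith
      exact le_of_mul_le_mul_left this (by linarith)
    have h4 : d * (2 * A * d) = d * (s + 2 * y * (B - A)) := by rw [hdA]
    nlinarith

lemma huber_le_of_switch {a a' t s y W : ℝ} (ha : 0 < a)
    (haa : a * a' ^ 2 ≤ a' - a) (hs : 0 < s) (hst : s < t) (hy : |y| ≤ 1)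
    (hW : W = 2 * (a * t) * y ∨ y = 1 ∨ y = -1) :
    y * W + a * t * (1 - y ^ 2) ≤ -(s * y) + huber (a' * (t - s)) (W + s) := by
  have haa' : a ≤ a' := by nlinarith [mul_nonneg ha.le (sq_nonneg a')]
  have hb : 0 < a' * (t - s) := mul_pos (ha.trans_le haa') (by linarith)
  rcases hW with rfl | rfl | rfl
  · obtain ⟨z, hz, h⟩ := exists_slope ha haa hs hst hy
    have := le_huber (2 * (a * t) * y + s) hb hz
    linarith
  · have := le_huber (W + s) hb hy
    linarith
  · have := le_huber (W + s) hb hy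
    linarith

lemma huber_le_of_stay {a t y W : ℝ} (ha : 0 < a) (ha1 : a ≤ 1 / 2) (ht : 0 < t)
    (hy : |y| ≤ 1) (hW : W = 2 * (a * t) * y ∨ y = 1 ∨ y = -1) :
    y * W + a * t * (1 - y ^ 2) ≤ -(t * y) + |W + t| := by
  obtain ⟨hy1, hy2⟩ := abs_le.1 hy
  have h1 := le_abs_self (W + t)
  have h2 := neg_abs_le (W + t)
  rcases hW with rfl | rfl | rfl
  · have : 0 ≤ (1 - y) * t * (1 - a * (1 - y)) :=
      mul_nonneg (mul_nonneg (by linarith) ht.le) (by nlinarith)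
    nlinarith
  · linarith
  · linarith

/-- Against any action `x`, one of the two constant adversary moves `±1` preserves the Huber
potential whenever the player next switches. -/
lemma exists_sign {a t : ℝ} (W x : ℝ) (ha : 0 < a) (ha1 : a ≤ 1 / 2) (ht : 0 < t) :
    ∃ w : ℝ, (w = 1 ∨ w = -1) ∧ huber (a * t) W ≤ t * (w * x) + |W + t * w| ∧
      ∀ a' s : ℝ, a * a' ^ 2 ≤ a' - a → 0 < s → s < t →
        huber (a * t) W ≤ s * (w * x) + huber (a' * (t - s)) (W + s * w) := by
  obtain ⟨y, hy, hval, hW'⟩ := exists_huber_eq W (mul_pos ha ht)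
  rw [hval]
  rcases le_total (-y) x with hx | hx
  · refine ⟨1, Or.inl rfl, ?_, fun a' s haa hs hst => ?_⟩
    · have := huber_le_of_stay ha ha1 ht hy hW'
      rw [mul_one]
      nlinarith
    · have := huber_le_of_switch ha haa hs hst hy hW'
      rw [mul_one]
      nlinarith
  · have hy' : |-y| ≤ 1 := by rwa [abs_neg]
    have hWn : -W = 2 * (a * t) * (-y) ∨ -y = 1 ∨ -y = -1 := by
      rcases hW' with h | h | h
      · exact Or.inl (by linarith)
      · exact Or.inr (Or.inr (by linarith))
      · exact Or.inr (Or.inl (by linarith))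
    refine ⟨-1, Or.inr rfl, ?_, fun a' s haa hs hst => ?_⟩
    · have := huber_le_of_stay ha ha1 ht hy' hWn
      rw [show -W + t = -(W + t * -1) by ring, abs_neg] at this
      nlinarith
    · have := huber_le_of_switch ha haa hs hst hy' hWn
      rw [show -W + s = -(W + s * -1) by ring, huber_neg] at this
      nlinarith

lemma abs_sSup_le {S : Set ℝ} {B : ℝ} (hB : 0 ≤ B) (h : ∀ r ∈ S, |r| ≤ B) : |sSup S| ≤ B := by
  rcases S.eq_empty_or_nonempty with rfl | ⟨r, hr⟩
  · simpa using hB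
  · exact abs_le.2 ⟨le_csSup_of_le ⟨B, fun r hr => (abs_le.1 (h r hr)).2⟩ hr (abs_le.1 (h r hr)).1,
      csSup_le ⟨r, hr⟩ fun r hr => (abs_le.1 (h r hr)).2⟩

lemma abs_sInf_le {S : Set ℝ} {B : ℝ} (hB : 0 ≤ B) (h : ∀ r ∈ S, |r| ≤ B) : |sInf S| ≤ B := by
  rw [Real.sInf_def, abs_neg]
  refine abs_sSup_le hB fun r hr => ?_
  rw [← abs_neg]
  exact h _ hr

lemma abs_gameVal1_le (K t : ℕ) (last : Option ℝ) (s : ℕ) (W : ℝ) :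
    |gameVal1 K t last s W| ≤ |W| + 2 * t := by
  induction t generalizing last s W with
  | zero => simp [gameVal1]
  | succ t ih =>
    rw [gameVal1]
    apply abs_sInf_le (by positivity)
    rintro _ ⟨x, ⟨hx, -⟩, rfl⟩
    apply abs_sSup_le (by positivity)
    rintro _ ⟨w, hw, rfl⟩
    have hx' : |x| ≤ 1 := abs_le.2 hx
    have hw' : |w| ≤ 1 := abs_le.2 hw
    have h1 := ih (some x) (s + switchInc last x) (W + w)
    have h2 := abs_add_le W w
    have h3 : |w * x| ≤ 1 := by
      rw [abs_mul]
      exact mul_le_one₀ hw' (abs_nonneg _) hx'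
    refine (abs_add_le _ _).trans ?_
    push_cast
    linarith

lemma le_sSup_gameVal1 (K t : ℕ) (last : Option ℝ) (s : ℕ) (W x : ℝ) (hx : x ∈ Set.Icc (-1 : ℝ) 1)
    {w : ℝ} (hw : w = 1 ∨ w = -1) :
    w * x + gameVal1 K t last s (W + w) ≤
      sSup ((fun w : ℝ => w * x + gameVal1 K t last s (W + w)) '' Set.Icc (-1 : ℝ) 1) := by
  refine le_csSup ⟨|W| + 2 + 2 * t, ?_⟩ ⟨w, ?_, rfl⟩
  · rintro _ ⟨v, hv, rfl⟩
    have hv' : |v| ≤ 1 := abs_le.2 hv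
    have h1 := (le_abs_self _).trans (abs_gameVal1_le K t last s (W + v))
    have h2 := abs_add_le W v
    have h3 : |v * x| ≤ 1 := by
      rw [abs_mul]
      exact mul_le_one₀ hv' (abs_nonneg _) (abs_le.2 hx)
    have h4 := le_abs_self (v * x)
    simp only
    linarith
  · rcases hw with rfl | rfl <;> constructor <;> norm_num

/-- The lower bound per round when `k` constant segments are available. -/
noncomputable def regretRate (k : ℕ) : ℝ := 1 / (2 * Real.sqrt k)

lemma regretRate_pos (k : ℕ) : 0 < regretRate (k + 1) := by
  unfold regretRate
  positivity

lemma regretRate_le (k : ℕ) : regretRate (k + 1) ≤ 1 / 2 := by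
  unfold regretRate
  have : 1 ≤ Real.sqrt ((k + 1 : ℕ) : ℝ) :=
    Real.one_le_sqrt.2 (by push_cast; linarith [k.cast_nonneg (α := ℝ)])
  exact one_div_le_one_div_of_le (by norm_num) (by linarith)

lemma regretRate_step (k : ℕ) :
    regretRate (k + 2) * regretRate (k + 1) ^ 2 ≤ regretRate (k + 1) - regretRate (k + 2) := by
  unfold regretRate
  have hp : 0 < Real.sqrt ((k + 1 : ℕ) : ℝ) := Real.sqrt_pos.2 (by positivity)
  have hq : 0 < Real.sqrt ((k + 2 : ℕ) : ℝ) := Real.sqrt_pos.2 (by positivity)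
  have hp2 := Real.sq_sqrt (Nat.cast_nonneg (α := ℝ) (k + 1))
  have hq2 := Real.sq_sqrt (Nat.cast_nonneg (α := ℝ) (k + 2))
  set p := Real.sqrt ((k + 1 : ℕ) : ℝ)
  set q := Real.sqrt ((k + 2 : ℕ) : ℝ)
  push_cast at hp2 hq2
  have hk : (0 : ℝ) ≤ k := k.cast_nonneg
  have hqp : q ≤ 3 * p := by nlinarith
  have hdiff : (q - p) * (q + p) = 1 := by nlinarith
  have hmain : 1 ≤ 4 * p * (q - p) := by
    have : 0 < q - p := by
      by_contra hcon
      nlinarith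
    nlinarith
  have : 1 / (2 * p) - 1 / (2 * q) - 1 / (2 * q) * (1 / (2 * p)) ^ 2 =
      (4 * p * (q - p) - 1) / (8 * p ^ 2 * q) := by
    field_simp
    ring
  have h0 : 0 ≤ (4 * p * (q - p) - 1) / (8 * p ^ 2 * q) :=
    div_nonneg (by linarith) (by positivity)
  linarith

/-- A constant adversary move `w` guarantees `L` if it does so both when the player never
switches again and, via the Huber potential, at the player's next switch. -/
lemma le_gameVal1_some (K t s k : ℕ) (hk : s + k + 1 = K) (x : ℝ) (hx : x ∈ Set.Icc (-1 : ℝ) 1)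
    (W w L : ℝ) (hw : w = 1 ∨ w = -1) (hstay : L ≤ t * (w * x) + |W + t * w|)
    (hswitch : 1 ≤ k → ∀ j : ℕ, j < t →
      L ≤ j * (w * x) + huber (regretRate k * (t - j)) (W + j * w)) :
    L ≤ gameVal1 K t (some x) s W := by
  induction t generalizing s k x W w L with
  | zero => simpa [gameVal1] using hstay
  | succ t ih =>
    rw [gameVal1]
    refine le_csInf ⟨_, x, ⟨hx, by simp [switchInc]; omega⟩, rfl⟩ ?_
    rintro _ ⟨x', ⟨hx', hlt⟩, rfl⟩
    by_cases hxx : x' = x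
    · subst hxx
      have hinc : switchInc (some x') x' = 0 := by simp [switchInc]
      simp only [hinc, add_zero]
      refine le_trans ?_ (le_sSup_gameVal1 K t (some x') s W x' hx hw)
      have : L - w * x' ≤ gameVal1 K t (some x') s (W + w) := by
        refine ih s k hk x' hx (W + w) w _ hw ?_ fun hk1 j hj => ?_
        · push_cast at hstay
          rw [show W + w + t * w = W + (t + 1) * w by ring]
          linarith
        · have := hswitch hk1 (j + 1) (by omega)
          push_cast at this
          rw [show W + w + j * w = W + (j + 1) * w by ring,
            show (t : ℝ) - j = t + 1 - (j + 1) by ring]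
          linarith
      linarith
    · have hinc : switchInc (some x) x' = 1 := by simp [switchInc, hxx]
      rw [hinc] at hlt
      simp only [hinc]
      obtain ⟨m, rfl⟩ : ∃ m, k = m + 1 := ⟨k - 1, by omega⟩
      have hL := hswitch (by omega) 0 (by omega)
      simp only [Nat.cast_zero, zero_mul, sub_zero, add_zero, zero_add] at hL
      obtain ⟨v, hv, hvstay, hvswitch⟩ := exists_sign W x' (regretRate_pos m) (regretRate_le m)
        (t := ((t + 1 : ℕ) : ℝ)) (by positivity)
      refine le_trans ?_ (le_sSup_gameVal1 K t (some x') (s + 1) W x' hx' hv)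
      have : L - v * x' ≤ gameVal1 K t (some x') (s + 1) (W + v) := by
        refine ih (s + 1) m (by omega) x' hx' (W + v) v _ hv ?_ fun hm j hj => ?_
        · push_cast at hvstay hL
          rw [show W + v + t * v = W + (t + 1) * v by ring]
          linarith
        · obtain ⟨n, rfl⟩ : ∃ n, m = n + 1 := ⟨m - 1, by omega⟩
          have hj' : (j : ℝ) < t := by exact_mod_cast hj
          have := hvswitch _ (j + 1) (regretRate_step n) (by positivity) (by push_cast; linarith)
          push_cast at this hL
          rw [show W + v + j * v = W + (j + 1) * v by ring,
            show (t : ℝ) - j = t + 1 - (j + 1) by ring]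
          linarith
      linarith

/-- For all integers `T ≥ K ≥ 1`, the minimax regret of one-dimensional
switching-constrained online linear optimization satisfies `R₁(T,K) ≥ T/(2√K)`. -/
theorem stmt2 (T K : ℕ) (hK : 1 ≤ K) (hTK : K ≤ T) :
    (T : ℝ) / (2 * Real.sqrt K) ≤ R1 T K := by
  obtain ⟨m, rfl⟩ : ∃ m, K = m + 1 := ⟨K - 1, by omega⟩
  obtain ⟨t, rfl⟩ : ∃ t, T = t + 1 := ⟨T - 1, by omega⟩
  have hb : 0 < regretRate (m + 1) * ((t + 1 : ℕ) : ℝ) :=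
    mul_pos (regretRate_pos m) (by positivity)
  have hzero := le_huber 0 hb (y := 0) (by simp)
  have hval : ((t + 1 : ℕ) : ℝ) / (2 * Real.sqrt ((m + 1 : ℕ) : ℝ)) =
      regretRate (m + 1) * ((t + 1 : ℕ) : ℝ) := by
    unfold regretRate
    ring
  rw [hval, R1, gameVal1]
  refine le_csInf ⟨_, 0, ⟨by simp, by simp [switchInc]⟩, rfl⟩ ?_
  rintro _ ⟨x, ⟨hx, -⟩, rfl⟩
  have hinc : switchInc none x = 0 := rfl
  simp only [hinc, add_zero]
  obtain ⟨v, hv, hvstay, hvswitch⟩ := exists_sign 0 x (regretRate_pos m) (regretRate_le m)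
    (t := ((t + 1 : ℕ) : ℝ)) (by positivity)
  refine le_trans ?_ (le_sSup_gameVal1 (m + 1) t (some x) 0 0 x hx hv)
  have : huber (regretRate (m + 1) * ((t + 1 : ℕ) : ℝ)) 0 - v * x ≤
      gameVal1 (m + 1) t (some x) 0 (0 + v) := by
    refine le_gameVal1_some (m + 1) t 0 m (by omega) x hx (0 + v) v _ hv ?_ fun hm j hj => ?_
    · push_cast at hvstay ⊢
      rw [show 0 + v + t * v = 0 + (t + 1) * v by ring]
      linarith
    · obtain ⟨n, rfl⟩ : ∃ n, m = n + 1 := ⟨m - 1, by omega⟩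
      have hj' : (j : ℝ) < t := by exact_mod_cast hj
      have := hvswitch _ (j + 1) (regretRate_step n) (by positivity) (by push_cast; linarith)
      push_cast at this ⊢
      rw [show 0 + v + j * v = 0 + (j + 1) * v by ring,
        show (t : ℝ) - j = t + 1 - (j + 1) by ring]
      linarith
  linarith
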